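/- arXiv:2306.10614 — 5 statements merged into one kernel-verified Lean document; each statement's English description precedes it below -/
import Mathlib

section
/- Consider two parameterizations θ = (μ_{X*}, σ_{X*}, μ_Y, τ, σ) and θ' = (μ'_{X*}, σ'_{X*}, μ'_Y, τ', σ') of the CEME measurement error model, with σ_{X*}(z), σ'_{X*}(z) > 0 for every z and τ, τ', σ, σ' > 0, and suppose each satisfies: (1) for every z, the map x* ↦ μ_Y(z, x*) is continuously differentiable on ℝ; (2) for every z, the set {x* ∈ ℝ : ∂μ_Y(z, x*)/∂x* = 0} is finite; (3) there exists a value z for which x* ↦ μ_Y(z, x*) is not affine (not of the form a·x* + b). If the observed conditional densities agree, i.e. p_θ(x, y | z) = p_{θ'}(x, y | z) for all z, x, y, then θ = θ': μ_{X*} = μ'_{X*} and σ_{X*} = σ'_{X*} pointwise, μ_Y = μ'_Y pointwise, τ = τ', and σ = σ'. -/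
open MeasureTheory Real Set

/-- Density of the normal distribution `N(μ, s²)`, evaluated at `u`. -/
noncomputable def gaussPDF (μ s u : ℝ) : ℝ :=
  (Real.sqrt (2 * Real.pi) * s)⁻¹ * Real.exp (-((u - μ) ^ 2) / (2 * s ^ 2))

/-- Observed conditional density `p_θ(x, y | z)` of the CEME measurement error model with
parameters `θ = (μX, σX, μY, τ, σ)`:
`X* | Z = z ~ N(μX z, (σX z)²)`, `X = X* + ΔX` with `ΔX ~ N(0, τ²)`, and
`Y = μY Z X* + ΔY` with `ΔY ~ N(0, σ²)`, errors independent of everything else. -/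
noncomputable def cemeDensity {Z : Type*} (μX σX : Z → ℝ) (μY : Z → ℝ → ℝ)
    (τ σ : ℝ) (z : Z) (x y : ℝ) : ℝ :=
  ∫ xstar : ℝ, gaussPDF (μX z) (σX z) xstar * gaussPDF xstar τ x *
    gaussPDF (μY z xstar) σ y

open ProbabilityTheory

noncomputable abbrev cemeGR (m s : ℝ) : Measure ℝ :=
  gaussianReal m (NNReal.mk (s ^ 2) (sq_nonneg s))

lemma ceme_mk_ne {s : ℝ} (hs : 0 < s) : NNReal.mk (s ^ 2) (sq_nonneg s) ≠ 0 := by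
  intro h
  have := congrArg NNReal.toReal h
  simp at this
  exact hs.ne' this

lemma ceme_pdf_eq {s : ℝ} (hs : 0 < s) (m u : ℝ) :
    gaussPDF m s u = gaussianPDFReal m (NNReal.mk (s ^ 2) (sq_nonneg s)) u := by
  simp only [gaussPDF, gaussianPDFReal, NNReal.coe_mk]
  rw [Real.sqrt_mul (by positivity : (0:ℝ) ≤ 2 * π) (s ^ 2), Real.sqrt_sq hs.le]

lemma ceme_int_eq {s : ℝ} (hs : 0 < s) (m : ℝ) (f : ℝ → ℂ) :
    ∫ u, f u ∂(cemeGR m s) = ∫ u, (gaussPDF m s u : ℂ) * f u := by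
  rw [integral_gaussianReal_eq_integral_smul (ceme_mk_ne hs)]
  simp only [ceme_pdf_eq hs, Complex.real_smul]

lemma ceme_charFun {s : ℝ} (m w : ℝ) :
    ∫ u, Complex.exp (w * u * Complex.I) ∂(cemeGR m s)
      = Complex.exp (w * m * Complex.I - (s : ℂ) ^ 2 * w ^ 2 / 2) := by
  have := charFun_gaussianReal (μ := m) (v := NNReal.mk (s ^ 2) (sq_nonneg s)) w
  rw [charFun_apply_real] at this
  rw [this]; simp

lemma ceme_charFun' {s : ℝ} (hs : 0 < s) (m w : ℝ) :
    ∫ u, (gaussPDF m s u : ℂ) * Complex.exp (w * u * Complex.I)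
      = Complex.exp (-(s : ℂ) ^ 2 * w ^ 2 / 2) * Complex.exp (w * m * Complex.I) := by
  rw [← ceme_int_eq hs, ceme_charFun, ← Complex.exp_add]
  congr 1; ring

lemma ceme_cont (s : ℝ) : Continuous (fun p : ℝ × ℝ => gaussPDF p.1 s p.2) := by
  unfold gaussPDF; fun_prop

lemma ceme_pdf_nonneg {s : ℝ} (hs : 0 < s) (m u : ℝ) : 0 ≤ gaussPDF m s u := by
  unfold gaussPDF; positivity

lemma ceme_pdf_pos {s : ℝ} (hs : 0 < s) (m u : ℝ) : 0 < gaussPDF m s u := by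
  unfold gaussPDF; positivity

lemma ceme_pdf_le {s : ℝ} (hs : 0 < s) (m u : ℝ) :
    gaussPDF m s u ≤ (Real.sqrt (2 * Real.pi) * s)⁻¹ := by
  unfold gaussPDF
  apply mul_le_of_le_one_right (by positivity)
  rw [Real.exp_le_one_iff]
  apply div_nonpos_of_nonpos_of_nonneg
  · nlinarith [sq_nonneg (u - m)]
  · positivity

lemma ceme_pdf_integrable {s : ℝ} (hs : 0 < s) (m : ℝ) : Integrable (gaussPDF m s) := by
  have : gaussPDF m s = gaussianPDFReal m (NNReal.mk (s ^ 2) (sq_nonneg s)) := by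
    ext u; exact ceme_pdf_eq hs m u
  rw [this]; exact integrable_gaussianPDFReal _ _

lemma ceme_pdf_integral {s : ℝ} (hs : 0 < s) (m : ℝ) : ∫ u, gaussPDF m s u = 1 := by
  simp only [ceme_pdf_eq hs]
  exact integral_gaussianPDFReal_eq_one m (ceme_mk_ne hs)

lemma ceme_exp_norm (a b : ℝ) : ‖Complex.exp (a * b * Complex.I)‖ = 1 := by
  rw [← Complex.ofReal_mul]; exact Complex.norm_exp_ofReal_mul_I _

lemma ceme_fub_int (ν : Measure ℝ) [IsFiniteMeasure ν] (h : ℝ → ℂ) (hh : Continuous h) (C : ℝ)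
    (hC : ∀ u, ‖h u‖ ≤ C) (c : ℝ → ℝ) (hc : Continuous c) {τ : ℝ} (hτ : 0 < τ) (w : ℝ) :
    Integrable (fun p : ℝ × ℝ => h p.1 * (gaussPDF (c p.1) τ p.2 : ℂ) *
      Complex.exp (w * p.2 * Complex.I)) (ν.prod volume) := by
  have hcont : Continuous (fun p : ℝ × ℝ => h p.1 * (gaussPDF (c p.1) τ p.2 : ℂ) *
      Complex.exp (w * p.2 * Complex.I)) := by
    have : Continuous (fun p : ℝ × ℝ => gaussPDF (c p.1) τ p.2) :=
      (ceme_cont τ).comp (by fun_prop : Continuous (fun p : ℝ × ℝ => (c p.1, p.2)))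
    fun_prop
  have hn : ∀ u x, ‖h u * (gaussPDF (c u) τ x : ℂ) * Complex.exp (w * x * Complex.I)‖
      = ‖h u‖ * gaussPDF (c u) τ x := by
    intro u x
    rw [norm_mul, norm_mul, ceme_exp_norm, mul_one, Complex.norm_real, Real.norm_eq_abs,
      abs_of_nonneg (ceme_pdf_nonneg hτ _ _)]
  rw [integrable_prod_iff hcont.aestronglyMeasurable]
  constructor
  · refine Filter.Eventually.of_forall fun u => ?_
    refine ((ceme_pdf_integrable hτ (c u)).const_mul ‖h u‖).mono'
      (hcont.comp (by fun_prop : Continuous fun x : ℝ => (u, x))).aestronglyMeasurable ?_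
    exact Filter.Eventually.of_forall fun x => (hn u x).le
  · simp only [hn, integral_const_mul, ceme_pdf_integral hτ, mul_one]
    refine (integrable_const C).mono' hh.norm.aestronglyMeasurable ?_
    exact Filter.Eventually.of_forall fun u => by simpa using hC u

lemma ceme_fub (ν : Measure ℝ) [IsFiniteMeasure ν] (h : ℝ → ℂ) (hh : Continuous h) (C : ℝ)
    (hC : ∀ u, ‖h u‖ ≤ C) (c : ℝ → ℝ) (hc : Continuous c) {τ : ℝ} (hτ : 0 < τ) (w : ℝ) :
    ∫ x, (∫ u, h u * (gaussPDF (c u) τ x : ℂ) ∂ν) * Complex.exp (w * x * Complex.I)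
      = Complex.exp (-(τ : ℂ) ^ 2 * w ^ 2 / 2) *
        ∫ u, h u * Complex.exp (w * c u * Complex.I) ∂ν := by
  simp only [← integral_mul_const]
  rw [← integral_integral_swap (ceme_fub_int ν h hh C hC c hc hτ w)]
  simp only [mul_assoc (h _), integral_const_mul, ceme_charFun' hτ]
  rw [← integral_const_mul]
  congr 1; ext u; ring

lemma ceme_fub_integrable (ν : Measure ℝ) [IsFiniteMeasure ν] (h : ℝ → ℂ) (hh : Continuous h)
    (C : ℝ) (hC : ∀ u, ‖h u‖ ≤ C) {τ : ℝ} (hτ : 0 < τ) :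
    Integrable (fun x => ∫ u, h u * (gaussPDF u τ x : ℂ) ∂ν) := by
  have := (ceme_fub_int ν h hh C hC id continuous_id hτ 0).integral_prod_right
  simpa using this

lemma ceme_fub_cont (ν : Measure ℝ) [IsFiniteMeasure ν] (h : ℝ → ℂ) (hh : Continuous h)
    (C : ℝ) (hC : ∀ u, ‖h u‖ ≤ C) {τ : ℝ} (hτ : 0 < τ) :
    Continuous (fun x => ∫ u, h u * (gaussPDF u τ x : ℂ) ∂ν) := by
  have hc1 : ∀ x, Continuous (fun u => gaussPDF u τ x) := fun x =>
    (ceme_cont τ).comp (by fun_prop : Continuous fun u : ℝ => (u, x))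
  have hc2 : ∀ u, Continuous (fun x => gaussPDF u τ x) := fun x =>
    (ceme_cont τ).comp (by fun_prop : Continuous fun u : ℝ => (x, u))
  refine continuous_of_dominated (bound := fun _ => C * (Real.sqrt (2 * Real.pi) * τ)⁻¹)
    ?_ ?_ (integrable_const _) ?_
  · intro x
    have := hc1 x
    exact (by fun_prop : Continuous fun u => h u * (gaussPDF u τ x : ℂ)).aestronglyMeasurable
  · intro x
    refine Filter.Eventually.of_forall fun u => ?_
    rw [norm_mul, Complex.norm_real, Real.norm_eq_abs, abs_of_nonneg (ceme_pdf_nonneg hτ _ _)]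
    have := ceme_pdf_le hτ u x
    have := ceme_pdf_nonneg hτ u x
    have := hC u
    have := norm_nonneg (h u)
    gcongr
    linarith
  · refine Filter.Eventually.of_forall fun u => ?_
    have := hc2 u
    fun_prop

lemma ceme_fourier_inj (f : ℝ → ℂ) (hf : Continuous f) (hi : Integrable f)
    (h0 : ∀ w : ℝ, ∫ x, f x * Complex.exp (w * x * Complex.I) = 0) : f = 0 := by
  have hF : FourierTransform.fourier f = 0 := by
    ext w
    rw [Real.fourier_real_eq_integral_exp_smul]
    have := h0 (-2 * π * w)
    simp only [Pi.zero_apply]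
    rw [← this]
    congr 1; ext x
    rw [smul_eq_mul, mul_comm]
    congr 2
    push_cast; ring
  have := hf.fourierInv_fourier_eq hi (by rw [hF]; exact integrable_zero _ _ _)
  rw [← this, hF]
  ext x
  simp [Real.fourierInv_eq]

lemma ceme_exp_inj (a b : ℝ) (v v' : NNReal)
    (h : ∀ t : ℝ, Complex.exp (t * a * Complex.I - v * t ^ 2 / 2)
      = Complex.exp (t * b * Complex.I - v' * t ^ 2 / 2)) : a = b ∧ v = v' := by
  have : gaussianReal a v = gaussianReal b v' := by
    apply Measure.ext_of_charFun
    ext t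
    rw [charFun_gaussianReal, charFun_gaussianReal]
    simpa using h t
  exact gaussianReal_ext_iff.1 this

lemma ceme_joint {Z : Type*} (μX σX : Z → ℝ) (μY : Z → ℝ → ℝ) {τ σ : ℝ} (z : Z)
    (hs : 0 < σX z) (hτ : 0 < τ) (hσ : 0 < σ) (hg : Continuous (μY z)) (w t : ℝ) :
    ∫ x, (∫ y, (cemeDensity μX σX μY τ σ z x y : ℂ) * Complex.exp (t * y * Complex.I)) *
        Complex.exp (w * x * Complex.I)
      = Complex.exp (-(σ : ℂ) ^ 2 * t ^ 2 / 2) * (Complex.exp (-(τ : ℂ) ^ 2 * w ^ 2 / 2) *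
        ∫ u, Complex.exp (t * μY z u * Complex.I) * Complex.exp (w * u * Complex.I)
          ∂(cemeGR (μX z) (σX z))) := by
  have h1 : ∀ x y, (cemeDensity μX σX μY τ σ z x y : ℂ)
      = ∫ u, (gaussPDF u τ x : ℂ) * (gaussPDF (μY z u) σ y : ℂ) ∂(cemeGR (μX z) (σX z)) := by
    intro x y
    rw [ceme_int_eq hs, cemeDensity, ← integral_complex_ofReal]
    congr 1; ext u; push_cast; ring
  have hc1 : ∀ x, Continuous (fun u => (gaussPDF u τ x : ℂ)) := fun x =>
    Complex.continuous_ofReal.comp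
      ((ceme_cont τ).comp (by fun_prop : Continuous fun u : ℝ => (u, x)))
  have h2 : ∀ x, ∫ y, (cemeDensity μX σX μY τ σ z x y : ℂ) * Complex.exp (t * y * Complex.I)
      = Complex.exp (-(σ : ℂ) ^ 2 * t ^ 2 / 2) *
        ∫ u, Complex.exp (t * μY z u * Complex.I) * (gaussPDF u τ x : ℂ)
          ∂(cemeGR (μX z) (σX z)) := by
    intro x
    simp only [h1]
    rw [ceme_fub (cemeGR (μX z) (σX z)) (fun u => (gaussPDF u τ x : ℂ)) (hc1 x)
      ((Real.sqrt (2 * Real.pi) * τ)⁻¹) ?_ (μY z) hg hσ t]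
    · congr 2; ext u; ring
    · intro u
      rw [Complex.norm_real, Real.norm_eq_abs, abs_of_nonneg (ceme_pdf_nonneg hτ _ _)]
      exact ceme_pdf_le hτ u x
  simp only [h2, mul_assoc (Complex.exp (-(σ : ℂ) ^ 2 * t ^ 2 / 2)), integral_const_mul]
  congr 1
  exact ceme_fub (cemeGR (μX z) (σX z)) (fun u => Complex.exp (t * μY z u * Complex.I))
    (by fun_prop) 1 (fun u => (ceme_exp_norm _ _).le) id continuous_id hτ w

/-- the basic characteristic function identity -/
def cemeEq (m s τ σ : ℝ) (g : ℝ → ℝ) (m' s' τ' σ' : ℝ) (g' : ℝ → ℝ) : Prop :=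
  ∀ w t : ℝ,
    Complex.exp (-(σ : ℂ) ^ 2 * t ^ 2 / 2) * (Complex.exp (-(τ : ℂ) ^ 2 * w ^ 2 / 2) *
        ∫ u, Complex.exp (t * g u * Complex.I) * Complex.exp (w * u * Complex.I)
          ∂(cemeGR m s)) =
    Complex.exp (-(σ' : ℂ) ^ 2 * t ^ 2 / 2) * (Complex.exp (-(τ' : ℂ) ^ 2 * w ^ 2 / 2) *
        ∫ u, Complex.exp (t * g' u * Complex.I) * Complex.exp (w * u * Complex.I)
          ∂(cemeGR m' s'))

lemma cemeEq_marg {m s τ σ m' s' τ' σ' : ℝ} {g g' : ℝ → ℝ}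
    (h : cemeEq m s τ σ g m' s' τ' σ' g') : m = m' ∧ s ^ 2 + τ ^ 2 = s' ^ 2 + τ' ^ 2 := by
  have := ceme_exp_inj m m' (NNReal.mk (s ^ 2 + τ ^ 2) (by positivity))
    (NNReal.mk (s' ^ 2 + τ' ^ 2) (by positivity)) (by
      intro w
      have h1 := h w 0
      simp only [Complex.ofReal_zero, zero_mul, Complex.exp_zero, one_mul, ceme_charFun] at h1
      norm_num at h1
      rw [← Complex.exp_add, ← Complex.exp_add] at h1
      convert h1 using 2 <;> (simp only [NNReal.coe_mk]; push_cast; ring))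
  exact ⟨this.1, by simpa using congrArg NNReal.toReal this.2⟩

lemma ceme_same {m s τ σ σ' : ℝ} {g g' : ℝ → ℝ} (hs : 0 < s) (hσ : 0 < σ) (hσ' : 0 < σ')
    (hg : Continuous g) (hg' : Continuous g')
    (h : cemeEq m s τ σ g m s τ σ' g') : σ = σ' ∧ ∀ x, g x = g' x := by
  have hpc : Continuous (gaussPDF m s) :=
    (ceme_cont s).comp (by fun_prop : Continuous fun u : ℝ => (m, u))
  have hI : ∀ (k : ℝ → ℝ), Continuous k → ∀ t w : ℝ, Integrable fun u =>
      (gaussPDF m s u : ℂ) * (Complex.exp (t * k u * Complex.I) *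
        Complex.exp (w * u * Complex.I)) := by
    intro k hk t w
    refine (ceme_pdf_integrable hs m).mono' (by fun_prop) ?_
    refine Filter.Eventually.of_forall fun u => ?_
    rw [norm_mul, norm_mul, ceme_exp_norm, ceme_exp_norm, Complex.norm_real, Real.norm_eq_abs,
      abs_of_nonneg (ceme_pdf_nonneg hs _ _)]
    simp
  have key : ∀ t x : ℝ, Complex.exp (-(σ : ℂ) ^ 2 * t ^ 2 / 2) * Complex.exp (t * g x * Complex.I)
      = Complex.exp (-(σ' : ℂ) ^ 2 * t ^ 2 / 2) * Complex.exp (t * g' x * Complex.I) := by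
    intro t x
    have hz := ceme_fourier_inj (fun u =>
      Complex.exp (-(σ : ℂ) ^ 2 * t ^ 2 / 2) *
        ((gaussPDF m s u : ℂ) * Complex.exp (t * g u * Complex.I)) -
      Complex.exp (-(σ' : ℂ) ^ 2 * t ^ 2 / 2) *
        ((gaussPDF m s u : ℂ) * Complex.exp (t * g' u * Complex.I))) (by fun_prop)
      (by
        have h1 := (hI g hg t 0).const_mul (Complex.exp (-(σ : ℂ) ^ 2 * t ^ 2 / 2))
        have h2 := (hI g' hg' t 0).const_mul (Complex.exp (-(σ' : ℂ) ^ 2 * t ^ 2 / 2))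
        simp only [Complex.ofReal_zero, zero_mul, Complex.exp_zero, mul_one] at h1 h2
        exact h1.sub h2)
      (by
        intro w
        have h1 := (hI g hg t w).const_mul (Complex.exp (-(σ : ℂ) ^ 2 * t ^ 2 / 2))
        have h2 := (hI g' hg' t w).const_mul (Complex.exp (-(σ' : ℂ) ^ 2 * t ^ 2 / 2))
        have h3 := h w t
        rw [ceme_int_eq hs, ceme_int_eq hs] at h3
        simp only [sub_mul, mul_assoc] at h1 h2 h3 ⊢
        rw [integral_sub h1 h2, integral_const_mul, integral_const_mul, sub_eq_zero]
        apply mul_left_cancel₀ (Complex.exp_ne_zero (-(τ : ℂ) ^ 2 * w ^ 2 / 2))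
        linear_combination h3)
    have := congrFun hz x
    simp only [Pi.zero_apply] at this
    have hp : (gaussPDF m s x : ℂ) ≠ 0 := by exact_mod_cast (ceme_pdf_pos hs m x).ne'
    apply mul_left_cancel₀ hp
    linear_combination this
  have key2 : ∀ x, g x = g' x ∧ NNReal.mk (σ ^ 2) (sq_nonneg σ) = NNReal.mk (σ' ^ 2) (sq_nonneg σ') := by
    intro x
    apply ceme_exp_inj
    intro t
    have := key t x
    rw [← Complex.exp_add, ← Complex.exp_add] at this
    convert this using 2 <;> (simp only [NNReal.coe_mk]; push_cast; ring)
  refine ⟨?_, fun x => (key2 x).1⟩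
  have := congrArg NNReal.toReal (key2 0).2
  simp only [NNReal.coe_mk] at this
  exact (pow_left_inj₀ hσ.le hσ'.le two_ne_zero).1 this

lemma ceme_posterior {s s' δ : ℝ} (hs : 0 < s) (hs' : 0 < s') (hδ : 0 < δ)
    (hh : s ^ 2 = s' ^ 2 + δ ^ 2) (m x u : ℝ) :
    gaussPDF m s' u * gaussPDF u δ x
      = gaussPDF m s x * gaussPDF (m + s' ^ 2 / s ^ 2 * (x - m)) (s' * δ / s) u := by
  unfold gaussPDF
  have e : -((u - m) ^ 2) / (2 * s' ^ 2) + -((x - u) ^ 2) / (2 * δ ^ 2)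
      = -((x - m) ^ 2) / (2 * s ^ 2) +
        -((u - (m + s' ^ 2 / s ^ 2 * (x - m))) ^ 2) / (2 * (s' * δ / s) ^ 2) := by
    have hd : δ ^ 2 = s ^ 2 - s' ^ 2 := by linarith
    have hd' : s ^ 2 - s' ^ 2 ≠ 0 := by rw [← hd]; positivity
    rw [div_pow, mul_pow, hd]
    field_simp
    ring
  have e2 : (Real.sqrt (2 * Real.pi) * s')⁻¹ * (Real.sqrt (2 * Real.pi) * δ)⁻¹
    = (Real.sqrt (2 * Real.pi) * s)⁻¹ * (Real.sqrt (2 * Real.pi) * (s' * δ / s))⁻¹ := by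
    field_simp
  rw [mul_mul_mul_comm, ← Real.exp_add, e, e2, Real.exp_add]
  ring

lemma ceme_diff {m s s' τ τ' σ σ' : ℝ} {g g' : ℝ → ℝ} (hs : 0 < s) (hs' : 0 < s')
    (hτ : 0 < τ) (hlt : τ < τ')
    (hv : s ^ 2 + τ ^ 2 = s' ^ 2 + τ' ^ 2)
    (hg : Continuous g) (hg' : Continuous g')
    (h : cemeEq m s τ σ g m s' τ' σ' g') :
    ∃ ρ κ : ℝ, 0 < ρ ∧ 0 < κ ∧ ∃ c : NNReal, ∀ x,
      (cemeGR (m + ρ * (x - m)) κ).map g' = gaussianReal (g x) c := by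
  obtain ⟨δ, hδ, hδ2⟩ : ∃ δ : ℝ, 0 < δ ∧ δ ^ 2 = τ' ^ 2 - τ ^ 2 := by
    have : 0 < τ' ^ 2 - τ ^ 2 := by nlinarith
    exact ⟨Real.sqrt (τ' ^ 2 - τ ^ 2), Real.sqrt_pos.2 this, Real.sq_sqrt this.le⟩
  have hκ : 0 < s' * δ / s := by positivity
  have hpc : Continuous (gaussPDF m s) :=
    (ceme_cont s).comp (by fun_prop : Continuous fun u : ℝ => (m, u))
  have key : ∀ t x : ℝ, Complex.exp (-(σ : ℂ) ^ 2 * t ^ 2 / 2) * Complex.exp (t * g x * Complex.I)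
      = Complex.exp (-(σ' : ℂ) ^ 2 * t ^ 2 / 2) *
        ∫ u, Complex.exp (t * g' u * Complex.I)
          ∂(cemeGR (m + s' ^ 2 / s ^ 2 * (x - m)) (s' * δ / s)) := by
    intro t x
    have hb : ∀ u, ‖Complex.exp (t * g' u * Complex.I)‖ ≤ 1 := fun u => (ceme_exp_norm _ _).le
    have hc2 := ceme_fub_cont (cemeGR m s') (fun u => Complex.exp (t * g' u * Complex.I))
      (by fun_prop) 1 hb hδ
    have hi2 := ceme_fub_integrable (cemeGR m s') (fun u => Complex.exp (t * g' u * Complex.I))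
      (by fun_prop) 1 hb hδ
    have hm : ∀ (f : ℝ → ℂ), Integrable f → ∀ w : ℝ,
        Integrable fun u : ℝ => f u * Complex.exp (w * u * Complex.I) := by
      intro f hf w
      refine hf.mul_bdd (c := 1) (by fun_prop) ?_
      exact Filter.Eventually.of_forall fun u => (ceme_exp_norm _ _).le
    have hi1 : Integrable fun u => (gaussPDF m s u : ℂ) * Complex.exp (t * g u * Complex.I) := by
      refine (ceme_pdf_integrable hs m).mono' (by fun_prop) ?_
      refine Filter.Eventually.of_forall fun u => ?_
      rw [norm_mul, ceme_exp_norm, Complex.norm_real, Real.norm_eq_abs,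
        abs_of_nonneg (ceme_pdf_nonneg hs _ _)]
      simp
    have hz := ceme_fourier_inj (fun x =>
      Complex.exp (-(σ : ℂ) ^ 2 * t ^ 2 / 2) *
        ((gaussPDF m s x : ℂ) * Complex.exp (t * g x * Complex.I)) -
      Complex.exp (-(σ' : ℂ) ^ 2 * t ^ 2 / 2) *
        (∫ u, Complex.exp (t * g' u * Complex.I) * (gaussPDF u δ x : ℂ) ∂(cemeGR m s')))
      (by fun_prop)
      ((hi1.const_mul _).sub (hi2.const_mul _))
      (by
        intro w
        have h1 := (hm _ hi1 w).const_mul (Complex.exp (-(σ : ℂ) ^ 2 * t ^ 2 / 2))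
        have h2 := (hm _ hi2 w).const_mul (Complex.exp (-(σ' : ℂ) ^ 2 * t ^ 2 / 2))
        have h3 := h w t
        have h4 := ceme_fub (cemeGR m s') (fun u => Complex.exp (t * g' u * Complex.I))
          (by fun_prop) 1 hb id continuous_id hδ w
        simp only [id] at h4
        rw [ceme_int_eq hs] at h3
        simp only [sub_mul]
        simp only [mul_assoc (Complex.exp (-(σ : ℂ) ^ 2 * t ^ 2 / 2)),
          mul_assoc (Complex.exp (-(σ' : ℂ) ^ 2 * t ^ 2 / 2))]
        rw [integral_sub h1 h2, integral_const_mul, integral_const_mul, sub_eq_zero, h4]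
        apply mul_left_cancel₀ (Complex.exp_ne_zero (-(τ : ℂ) ^ 2 * w ^ 2 / 2))
        have h5 : Complex.exp (-(τ' : ℂ) ^ 2 * w ^ 2 / 2) = Complex.exp (-(τ : ℂ) ^ 2 * w ^ 2 / 2)
            * Complex.exp (-(δ : ℂ) ^ 2 * w ^ 2 / 2) := by
          rw [← Complex.exp_add]
          congr 1
          have : (δ : ℂ) ^ 2 = (τ' : ℂ) ^ 2 - (τ : ℂ) ^ 2 := by exact_mod_cast hδ2
          rw [this]; ring
        rw [h5] at h3
        simp only [mul_assoc] at h3 ⊢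
        linear_combination h3)
    have := congrFun hz x
    simp only [Pi.zero_apply] at this
    have hp : (gaussPDF m s x : ℂ) ≠ 0 := by exact_mod_cast (ceme_pdf_pos hs m x).ne'
    have h6 : ∫ u, Complex.exp (t * g' u * Complex.I) * (gaussPDF u δ x : ℂ) ∂(cemeGR m s')
        = (gaussPDF m s x : ℂ) * ∫ u, Complex.exp (t * g' u * Complex.I)
          ∂(cemeGR (m + s' ^ 2 / s ^ 2 * (x - m)) (s' * δ / s)) := by
      rw [ceme_int_eq hs', ceme_int_eq hκ, ← integral_const_mul]
      congr 1; ext u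
      have := ceme_posterior hs hs' hδ (by linarith) m x u
      have : (gaussPDF m s' u : ℂ) * (gaussPDF u δ x : ℂ) = (gaussPDF m s x : ℂ) *
        (gaussPDF (m + s' ^ 2 / s ^ 2 * (x - m)) (s' * δ / s) u : ℂ) := by exact_mod_cast this
      linear_combination (Complex.exp (t * g' u * Complex.I)) * this
    rw [h6] at this
    apply mul_left_cancel₀ hp
    linear_combination this
  have hle : 0 ≤ σ ^ 2 - σ' ^ 2 := by
    have h1 := congrArg norm (key 1 0)
    have h2 : ‖∫ u, Complex.exp ((1:ℝ) * g' u * Complex.I)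
          ∂(cemeGR (m + s' ^ 2 / s ^ 2 * (0 - m)) (s' * δ / s))‖ ≤ 1 := by
      refine (norm_integral_le_of_norm_le_const (C := 1)
        (Filter.Eventually.of_forall fun u => (ceme_exp_norm _ _).le)).trans ?_
      simp
    rw [norm_mul, norm_mul, ceme_exp_norm, mul_one] at h1
    have e : ∀ q : ℝ, ‖Complex.exp (-(q : ℂ) ^ 2 * ((1:ℝ):ℂ) ^ 2 / 2)‖ = Real.exp (-q ^ 2 / 2) := by
      intro q
      rw [← Complex.norm_of_nonneg (Real.exp_pos _).le]
      push_cast; simp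
    rw [e, e] at h1
    have h3 : Real.exp (-σ ^ 2 / 2) ≤ Real.exp (-σ' ^ 2 / 2) := by
      rw [h1]; exact mul_le_of_le_one_right (Real.exp_pos _).le h2
    rw [Real.exp_le_exp] at h3
    linarith
  refine ⟨s' ^ 2 / s ^ 2, s' * δ / s, by positivity, hκ, NNReal.mk _ hle, fun x => ?_⟩
  have : IsProbabilityMeasure
    ((cemeGR (m + s' ^ 2 / s ^ 2 * (x - m)) (s' * δ / s)).map g') :=
    Measure.isProbabilityMeasure_map hg'.measurable.aemeasurable
  apply Measure.ext_of_charFun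
  ext t
  rw [charFun_apply_real, charFun_gaussianReal, integral_map hg'.measurable.aemeasurable
    (by fun_prop)]
  apply mul_left_cancel₀ (Complex.exp_ne_zero (-(σ' : ℂ) ^ 2 * t ^ 2 / 2))
  rw [← key t x, ← Complex.exp_add, ← Complex.exp_add]
  congr 1
  simp only [NNReal.coe_mk]; push_cast; ring

lemma ceme_half (F : ℝ → ℝ) (hF : Continuous F) (K L : ℝ)
    (hR : StrictMonoOn F (Ici K)) (hL : StrictMonoOn F (Iic L))
    (hub : ∀ y, ∃ x, y < F x) : ∃ y a, F ⁻¹' Iic y = Iic a := by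
  obtain ⟨M, hM⟩ := (isCompact_Icc (a := L) (b := K)).bddAbove_image hF.continuousOn
  have hM' : ∀ x ≤ K, F x ≤ max M (F L) := by
    intro x hx
    rcases le_total x L with h | h
    · exact (hL.monotoneOn h (mem_Iic.2 le_rfl) h).trans (le_max_right _ _)
    · exact (hM ⟨x, ⟨h, hx⟩, rfl⟩).trans (le_max_left _ _)
  set y := max M (F L) with hy
  obtain ⟨x1, hx1⟩ := hub y
  have hx1K : K ≤ x1 := by
    by_contra hc
    exact absurd (hM' x1 (not_le.1 hc).le) (not_le.2 hx1)
  obtain ⟨a, ha, hay⟩ := intermediate_value_Icc hx1K hF.continuousOn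
    ⟨hM' K le_rfl, hx1.le⟩
  refine ⟨y, a, ?_⟩
  ext x
  simp only [mem_preimage, mem_Iic]
  rcases le_total x K with h | h
  · exact ⟨fun _ => h.trans ha.1, fun _ => hM' x h⟩
  · rw [← hay]; exact hR.le_iff_le h ha.1

lemma ceme_bdd_of (F : ℝ → ℝ) (hF : Continuous F) (K L : ℝ)
    (hR : StrictAntiOn F (Ici K)) (hL : StrictMonoOn F (Iic L)) :
    ∃ M, ∀ x, F x ≤ M := by
  obtain ⟨M, hM⟩ := (isCompact_Icc (a := L) (b := K)).bddAbove_image hF.continuousOn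
  refine ⟨max M (max (F L) (F K)), fun x => ?_⟩
  rcases le_total x L with h | h
  · exact (hL.monotoneOn h (mem_Iic.2 le_rfl) h).trans (by simp)
  rcases le_total x K with h' | h'
  · exact (hM ⟨x, ⟨h, h'⟩, rfl⟩).trans (le_max_left _ _)
  · exact (hR.antitoneOn (mem_Ici.2 le_rfl) h' h').trans (by simp)

lemma ceme_mono_conv (F : ℝ → ℝ) (hF : ContDiff ℝ 1 F) (S : Set ℝ) (hS : Convex ℝ S)
    (h0 : ∀ x ∈ S, deriv F x ≠ 0) : StrictMonoOn F S ∨ StrictAntiOn F S := by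
  have hc : Continuous (deriv F) := hF.continuous_deriv le_rfl
  have hd : (∀ x ∈ S, 0 < deriv F x) ∨ (∀ x ∈ S, deriv F x < 0) := by
    by_contra hcon
    push Not at hcon
    obtain ⟨⟨x, hx, hx'⟩, ⟨y, hy, hy'⟩⟩ := hcon
    obtain ⟨u, hu, hu'⟩ := hS.isPreconnected.intermediate_value hx hy hc.continuousOn ⟨hx', hy'⟩
    exact h0 u hu hu'
  rcases hd with h | h
  · exact Or.inl (strictMonoOn_of_deriv_pos hS hF.continuous.continuousOn
      fun x hx => h x (interior_subset hx))
  · exact Or.inr (strictAntiOn_of_deriv_neg hS hF.continuous.continuousOn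
      fun x hx => h x (interior_subset hx))

lemma ceme_halfline (F : ℝ → ℝ) (hF : ContDiff ℝ 1 F) (hfin : {x : ℝ | deriv F x = 0}.Finite)
    (hub : ∀ y, ∃ x, y < F x) (hlb : ∀ y, ∃ x, F x < y) :
    ∃ y a, F ⁻¹' Iic y = Iic a ∨ F ⁻¹' Iic y = Ici a := by
  obtain ⟨B, hB⟩ := hfin.bddAbove
  obtain ⟨A, hA⟩ := hfin.bddBelow
  have hcF := hF.continuous
  have hR := ceme_mono_conv F hF (Ici (B + 1)) (convex_Ici _) (fun x hx h => by
    have := hB (show x ∈ {x : ℝ | deriv F x = 0} from h)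
    have := mem_Ici.1 hx
    linarith)
  have hL := ceme_mono_conv F hF (Iic (A - 1)) (convex_Iic _) (fun x hx h => by
    have := hA (show x ∈ {x : ℝ | deriv F x = 0} from h)
    have := mem_Iic.1 hx
    linarith)
  rcases hR with hR | hR <;> rcases hL with hL | hL
  · obtain ⟨y, a, h⟩ := ceme_half F hcF _ _ hR hL hub
    exact ⟨y, a, Or.inl h⟩
  · obtain ⟨M, hM⟩ := ceme_bdd_of (fun x => -F x) hcF.neg _ _
      (fun x hx y hy hxy => neg_lt_neg (hR hx hy hxy))
      (fun x hx y hy hxy => neg_lt_neg (hL hx hy hxy))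
    obtain ⟨x, hx⟩ := hlb (-M)
    have := hM x
    linarith
  · obtain ⟨M, hM⟩ := ceme_bdd_of F hcF _ _ hR hL
    obtain ⟨x, hx⟩ := hub M
    have := hM x
    linarith
  · obtain ⟨y, a, h⟩ := ceme_half (fun x => F (-x)) (by fun_prop) (-(A - 1)) (-(B + 1))
      (fun x hx y hy hxy => hL (mem_Iic.2 (by have := mem_Ici.1 hy; linarith))
        (mem_Iic.2 (by have := mem_Ici.1 hx; linarith)) (neg_lt_neg hxy))
      (fun x hx y hy hxy => hR (mem_Ici.2 (by have := mem_Iic.1 hy; linarith))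
        (mem_Ici.2 (by have := mem_Iic.1 hx; linarith)) (neg_lt_neg hxy))
      (fun y => by
        obtain ⟨x, hx⟩ := hub y
        exact ⟨-x, by simpa using hx⟩)
    refine ⟨y, -a, Or.inr ?_⟩
    ext x
    have := Set.ext_iff.1 h (-x)
    simp only [mem_preimage, mem_Iic, neg_neg, mem_Ici] at this ⊢
    rw [this]
    constructor <;> intro <;> linarith

lemma ceme_open_pos (m : ℝ) {v : NNReal} (hv : v ≠ 0) {U : Set ℝ} (hU : IsOpen U)
    (hne : U.Nonempty) : gaussianReal m v U ≠ 0 := fun h =>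
  hU.measure_ne_zero volume hne (gaussianReal_absolutelyContinuous' m hv h)

lemma ceme_std_inj {a b : ℝ} (h : gaussianReal 0 1 (Iic a) = gaussianReal 0 1 (Iic b)) :
    a = b := by
  have key : ∀ a b : ℝ, a < b → gaussianReal 0 1 (Iic a) ≠ gaussianReal 0 1 (Iic b) := by
    intro a b hab he
    have h1 : gaussianReal 0 1 (Iic b \ Iic a) = 0 := by
      rw [measure_sdiff (Iic_subset_Iic.2 hab.le) measurableSet_Iic.nullMeasurableSet
        (measure_ne_top _ _), he, tsub_self]
    refine ceme_open_pos 0 one_ne_zero (isOpen_Ioo (a := a) (b := b)) (nonempty_Ioo.2 hab) ?_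
    refine measure_mono_null ?_ h1
    intro x hx
    exact ⟨hx.2.le, not_le.2 hx.1⟩
  rcases lt_trichotomy a b with h' | h' | h'
  · exact absurd h (key a b h')
  · exact h'
  · exact absurd h.symm (key b a h')

lemma ceme_std_map (m s : ℝ) : cemeGR m s = (gaussianReal 0 1).map (fun x => s * x + m) := by
  have h1 := gaussianReal_map_const_mul (μ := 0) (v := 1) s
  have h2 := gaussianReal_map_add_const (μ := s * 0) (v := NNReal.mk (s ^ 2) (sq_nonneg s) * 1) m
  rw [← h1, Measure.map_map (by fun_prop) (by fun_prop)] at h2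
  simp only [mul_zero, zero_add, mul_one] at h2
  exact h2.symm

lemma ceme_cdf {s : ℝ} (hs : 0 < s) (m a : ℝ) :
    cemeGR m s (Iic a) = gaussianReal 0 1 (Iic ((a - m) / s)) := by
  rw [ceme_std_map, Measure.map_apply (by fun_prop) measurableSet_Iic]
  congr 1; ext x
  simp only [mem_preimage, mem_Iic]
  rw [le_div_iff₀ hs]
  constructor <;> intro <;> linarith

lemma ceme_cdf' {s : ℝ} (hs : 0 < s) (m a : ℝ) :
    cemeGR m s (Ici a) = gaussianReal 0 1 (Iic ((m - a) / s)) := by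
  have h1 := gaussianReal_map_neg (μ := -m) (v := NNReal.mk (s ^ 2) (sq_nonneg s))
  rw [neg_neg] at h1
  have h2 := ceme_cdf hs (-m) (-a)
  rw [cemeGR, ← h1, Measure.map_apply (by fun_prop) measurableSet_Ici]
  have : (fun x : ℝ => -x) ⁻¹' Ici a = Iic (-a) := by
    ext x; simp only [mem_preimage, mem_Iic, mem_Ici]; constructor <;> intro <;> linarith
  rw [this, h2]
  congr 3; ring

lemma ceme_affine (F : ℝ → ℝ) (hF : ContDiff ℝ 1 F) (hfin : {x : ℝ | deriv F x = 0}.Finite)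
    (f : ℝ → ℝ) (m ρ κ : ℝ) (hκ : 0 < κ) (c : NNReal)
    (h : ∀ x, (cemeGR (m + ρ * (x - m)) κ).map F = gaussianReal (f x) c) :
    ∃ a b : ℝ, ∀ x, f x = a * x + b := by
  have hFm := hF.continuous.measurable
  by_cases hc : c = 0
  · exfalso
    have h0 := h 0
    rw [hc, gaussianReal_zero_var] at h0
    have h1 : cemeGR (m + ρ * (0 - m)) κ (F ⁻¹' {f 0}ᶜ) = 0 := by
      rw [← Measure.map_apply hFm (measurableSet_singleton _).compl, h0]
      simp
    have hall : ∀ x, F x = f 0 := by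
      by_contra hcon
      push Not at hcon
      obtain ⟨x, hx⟩ := hcon
      exact ceme_open_pos _ (ceme_mk_ne hκ)
        ((isOpen_compl_singleton (x := f 0)).preimage hF.continuous) ⟨x, hx⟩ h1
    have hconst : F = fun _ => f 0 := funext hall
    rw [hconst] at hfin
    simp at hfin
    exact Set.infinite_univ hfin
  · have hub : ∀ y, ∃ x, y < F x := by
      intro y
      have h1 := ceme_open_pos (f 0) hc (isOpen_Ioi (a := y)) nonempty_Ioi
      rw [← h 0, Measure.map_apply hFm measurableSet_Ioi] at h1
      obtain ⟨x, hx⟩ := nonempty_of_measure_ne_zero h1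
      exact ⟨x, hx⟩
    have hlb : ∀ y, ∃ x, F x < y := by
      intro y
      have h1 := ceme_open_pos (f 0) hc (isOpen_Iio (a := y)) nonempty_Iio
      rw [← h 0, Measure.map_apply hFm measurableSet_Iio] at h1
      obtain ⟨x, hx⟩ := nonempty_of_measure_ne_zero h1
      exact ⟨x, hx⟩
    obtain ⟨q, hq, hqc⟩ : ∃ q : ℝ, 0 < q ∧ c = NNReal.mk (q ^ 2) (sq_nonneg q) := by
      have : 0 < (c : ℝ) := by positivity
      refine ⟨Real.sqrt c, Real.sqrt_pos.2 this, ?_⟩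
      ext
      simp [Real.sq_sqrt this.le]
    obtain ⟨y, a, hya⟩ := ceme_halfline F hF hfin hub hlb
    have h2 : ∀ x, cemeGR (m + ρ * (x - m)) κ (F ⁻¹' Iic y)
        = gaussianReal 0 1 (Iic ((y - f x) / q)) := by
      intro x
      rw [← Measure.map_apply hFm measurableSet_Iic, h x, hqc]
      exact ceme_cdf hq _ _
    rcases hya with hya | hya
    · refine ⟨q / κ * ρ, y - q / κ * (a - m + ρ * m), fun x => ?_⟩
      have h3 := h2 x
      rw [hya, ceme_cdf hκ] at h3
      have h4 := ceme_std_inj h3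
      field_simp at h4 ⊢
      linarith
    · refine ⟨- (q / κ * ρ), y + q / κ * (a - m + ρ * m), fun x => ?_⟩
      have h3 := h2 x
      rw [hya, ceme_cdf' hκ] at h3
      have h4 := ceme_std_inj h3
      field_simp at h4 ⊢
      linarith

lemma cemeEq_of {Z : Type*} {μX μX' σX σX' : Z → ℝ} {μY μY' : Z → ℝ → ℝ} {τ τ' σ σ' : ℝ} (z : Z)
    (hs : 0 < σX z) (hs' : 0 < σX' z) (hτ : 0 < τ) (hτ' : 0 < τ') (hσ : 0 < σ) (hσ' : 0 < σ')
    (hg : Continuous (μY z)) (hg' : Continuous (μY' z))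
    (hobs : ∀ x y, cemeDensity μX σX μY τ σ z x y = cemeDensity μX' σX' μY' τ' σ' z x y) :
    cemeEq (μX z) (σX z) τ σ (μY z) (μX' z) (σX' z) τ' σ' (μY' z) := by
  intro w t
  rw [← ceme_joint μX σX μY z hs hτ hσ hg, ← ceme_joint μX' σX' μY' z hs' hτ' hσ' hg']
  simp only [hobs]

lemma ceme_not_lt {m s m' s' τ τ' σ σ' : ℝ} {g g' : ℝ → ℝ} (hs : 0 < s) (hs' : 0 < s')
    (hτ : 0 < τ) (hg : Continuous g) (hg' : ContDiff ℝ 1 g')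
    (hfin : {x : ℝ | deriv g' x = 0}.Finite)
    (hnl : ¬ ∃ a b : ℝ, ∀ x : ℝ, g x = a * x + b)
    (h : cemeEq m s τ σ g m' s' τ' σ' g') : ¬ τ < τ' := by
  intro hlt
  obtain ⟨rfl, hv⟩ := cemeEq_marg h
  obtain ⟨ρ, κ, -, hκ, c, hc⟩ := ceme_diff hs hs' hτ hlt hv hg hg'.continuous h
  exact hnl (ceme_affine g' hg' hfin g m ρ κ hκ c hc)

/-- Identifiability of the CEME measurement error model (Proposition 1):
if two parameterizations, each satisfying (1) continuous differentiability of `x* ↦ μY z x*`,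
(2) finiteness of the critical set of `x* ↦ μY z x*` for every `z`, and
(3) existence of a `z` for which `x* ↦ μY z x*` is not affine,
induce the same observed conditional densities `p(x, y | z)` for all `z, x, y`,
then the parameterizations coincide. -/
theorem ceme_identifiable {Z : Type*}
    (μX μX' σX σX' : Z → ℝ) (μY μY' : Z → ℝ → ℝ) (τ τ' σ σ' : ℝ)
    (hσX : ∀ z, 0 < σX z) (hσX' : ∀ z, 0 < σX' z)
    (hτ : 0 < τ) (hτ' : 0 < τ') (hσ : 0 < σ) (hσ' : 0 < σ')
    (hC1 : ∀ z, ContDiff ℝ 1 (fun xstar => μY z xstar))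
    (hC1' : ∀ z, ContDiff ℝ 1 (fun xstar => μY' z xstar))
    (hfin : ∀ z, {xstar : ℝ | deriv (fun t => μY z t) xstar = 0}.Finite)
    (hfin' : ∀ z, {xstar : ℝ | deriv (fun t => μY' z t) xstar = 0}.Finite)
    (hnl : ∃ z, ¬ ∃ a b : ℝ, ∀ xstar : ℝ, μY z xstar = a * xstar + b)
    (hnl' : ∃ z, ¬ ∃ a b : ℝ, ∀ xstar : ℝ, μY' z xstar = a * xstar + b)
    (hobs : ∀ z x y, cemeDensity μX σX μY τ σ z x y = cemeDensity μX' σX' μY' τ' σ' z x y) :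
    (∀ z, μX z = μX' z) ∧ (∀ z, σX z = σX' z) ∧
      (∀ z xstar, μY z xstar = μY' z xstar) ∧ τ = τ' ∧ σ = σ' := by

  have hE : ∀ z, cemeEq (μX z) (σX z) τ σ (μY z) (μX' z) (σX' z) τ' σ' (μY' z) := fun z =>
    cemeEq_of z (hσX z) (hσX' z) hτ hτ' hσ hσ' (hC1 z).continuous (hC1' z).continuous (hobs z)
  have hE' : ∀ z, cemeEq (μX' z) (σX' z) τ' σ' (μY' z) (μX z) (σX z) τ σ (μY z) :=
    fun z w t => (hE z w t).symm
  have hττ : τ = τ' := by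
    obtain ⟨z, hz⟩ := hnl
    obtain ⟨z', hz'⟩ := hnl'
    exact le_antisymm
      (not_lt.1 (ceme_not_lt (hσX' z') (hσX z') hτ' (hC1' z').continuous (hC1 z') (hfin z') hz'
        (hE' z')))
      (not_lt.1 (ceme_not_lt (hσX z) (hσX' z) hτ (hC1 z).continuous (hC1' z) (hfin' z) hz (hE z)))
  subst hττ
  have hm : ∀ z, μX z = μX' z := fun z => (cemeEq_marg (hE z)).1
  have hs : ∀ z, σX z = σX' z := fun z => by
    have := (cemeEq_marg (hE z)).2
    exact (pow_left_inj₀ (hσX z).le (hσX' z).le two_ne_zero).1 (by linarith)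
  have hfinal : ∀ z, σ = σ' ∧ ∀ x, μY z x = μY' z x := fun z => by
    have := hE z
    rw [← hm z, ← hs z] at this
    exact ceme_same (hσX z) hσ hσ' (hC1 z).continuous (hC1' z).continuous this
  obtain ⟨z0, -⟩ := hnl
  exact ⟨hm, hs, fun z => (hfinal z).2, rfl, (hfinal z0).1⟩
end

section
/- Consider two parameterizations (m, s, g, τ, σ) and (m', s', g', τ', σ') of the covariate-free Gaussian measurement error model, with s, s' > 0 and τ, τ', σ, σ' > 0, and suppose each regression function g, g' : ℝ → ℝ is continuously differentiable, has at most finitely many points x* with g'(x*) = 0, and is not affine (not of the form a·x* + b). If the two models induce the same joint density of the observed pair (X, Y), i.e. ∫_ℝ φ(x*; m, s) φ(x; x*, τ) φ(y; g(x*), σ) dx* = ∫_ℝ φ(x*; m', s') φ(x; x*, τ') φ(y; g'(x*), σ') dx* for all x, y ∈ ℝ, then m = m', s = s', τ = τ', σ = σ', and g = g' pointwise on ℝ. -/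
open MeasureTheory Real Set

/-- Joint observed density `p(x, y)` of the covariate-free Gaussian measurement error model:
`X* ~ N(m, s²)`, `X = X* + ΔX` with `ΔX ~ N(0, τ²)`, `Y = g(X*) + ΔY` with `ΔY ~ N(0, σ²)`,
where `X*, ΔX, ΔY` are mutually independent. -/
noncomputable def covFreeDensity (m s : ℝ) (g : ℝ → ℝ) (τ σ : ℝ) (x y : ℝ) : ℝ :=
  ∫ xstar : ℝ, gaussPDF m s xstar * gaussPDF xstar τ x * gaussPDF (g xstar) σ y

open ProbabilityTheory

lemma gp_pos {μ s u : ℝ} (hs : 0 < s) : 0 < gaussPDF μ s u := by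
  unfold gaussPDF; positivity

lemma gp_cont {μ s : ℝ} : Continuous (gaussPDF μ s) := by
  unfold gaussPDF; fun_prop

lemma gp_cont2 {s u : ℝ} : Continuous (fun μ => gaussPDF μ s u) := by
  unfold gaussPDF; fun_prop

lemma gp_le {μ s u : ℝ} (hs : 0 < s) : gaussPDF μ s u ≤ (Real.sqrt (2 * Real.pi) * s)⁻¹ := by
  unfold gaussPDF
  have h : Real.exp (-((u - μ) ^ 2) / (2 * s ^ 2)) ≤ 1 := by
    rw [Real.exp_le_one_iff]
    apply div_nonpos_of_nonpos_of_nonneg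
    · nlinarith [sq_nonneg (u - μ)]
    · positivity
  have h2 : 0 ≤ (Real.sqrt (2 * Real.pi) * s)⁻¹ := by positivity
  nlinarith

lemma gp_eq {μ s u : ℝ} (hs : 0 < s) :
    gaussPDF μ s u = gaussianPDFReal μ (s ^ 2).toNNReal u := by
  unfold gaussPDF gaussianPDFReal
  rw [Real.coe_toNNReal _ (by positivity), Real.sqrt_mul (by positivity) (s ^ 2),
    Real.sqrt_sq hs.le]

lemma gp_int {μ s : ℝ} (hs : 0 < s) : Integrable (gaussPDF μ s) := by
  have : gaussPDF μ s = gaussianPDFReal μ (s ^ 2).toNNReal := by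
    ext u; exact gp_eq hs
  rw [this]; exact integrable_gaussianPDFReal _ _

lemma gp_shift {t s u : ℝ} : gaussPDF t s u = gaussPDF 0 s (-t + u) := by
  unfold gaussPDF; ring_nf

lemma gp_ident {A A' a a' σ σ' : ℝ} (hA : 0 < A) (hA' : 0 < A') (hσ : 0 < σ) (hσ' : 0 < σ')
    (h : ∀ y, A * gaussPDF a σ y = A' * gaussPDF a' σ' y) : a = a' ∧ σ = σ' ∧ A = A' := by
  have hl : ∀ y, Real.log A + Real.log ((Real.sqrt (2 * Real.pi) * σ)⁻¹)
      + -((y - a) ^ 2) / (2 * σ ^ 2) = Real.log A' + Real.log ((Real.sqrt (2 * Real.pi) * σ')⁻¹)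
      + -((y - a') ^ 2) / (2 * σ' ^ 2) := by
    intro y
    have := congrArg Real.log (h y)
    unfold gaussPDF at this
    rw [Real.log_mul hA.ne' (by positivity), Real.log_mul hA'.ne' (by positivity),
      Real.log_mul (by positivity) (by positivity), Real.log_mul (by positivity) (by positivity),
      Real.log_exp, Real.log_exp] at this
    linarith
  have h0 := hl 0
  have h1 := hl 1
  have h2 := hl (-1)
  have e : ∀ y a σ : ℝ, -((y - a) ^ 2) / (2 * σ ^ 2)
      = (σ ^ 2)⁻¹ * (-(y - a) ^ 2 / 2) := by
    intro y a σ; rw [div_eq_mul_inv, mul_inv]; ring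
  rw [e, e] at h0 h1 h2
  have k1 : (σ ^ 2)⁻¹ = (σ' ^ 2)⁻¹ := by linarith
  have hs : σ = σ' := by
    have := inv_injective k1
    nlinarith [sq_nonneg (σ - σ')]
  subst hs
  have hp : 0 < (σ ^ 2)⁻¹ := by positivity
  have ha : a = a' := by
    have : (σ ^ 2)⁻¹ * a = (σ ^ 2)⁻¹ * a' := by linarith
    exact mul_left_cancel₀ hp.ne' this
  subst ha
  exact ⟨rfl, rfl, mul_right_cancel₀ (gp_pos hσ).ne' (h 0)⟩

/-- Gaussian smoothing. -/
noncomputable def smG (h : ℝ → ℝ) (τ x : ℝ) : ℝ := ∫ t, h t * gaussPDF t τ x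

lemma smG_integrable {h : ℝ → ℝ} {τ : ℝ} (hτ : 0 < τ) (hi : Integrable h) (x : ℝ) :
    Integrable (fun t => h t * gaussPDF t τ x) := by
  refine hi.mul_bdd (c := (Real.sqrt (2 * Real.pi) * τ)⁻¹) gp_cont2.aestronglyMeasurable ?_
  filter_upwards with t
  rw [Real.norm_of_nonneg (gp_pos hτ).le]; exact gp_le hτ

lemma smG_cont {h : ℝ → ℝ} {τ : ℝ} (hτ : 0 < τ) (hi : Integrable h) :
    Continuous (smG h τ) := by
  unfold smG
  refine continuous_of_dominated (bound := fun t => ‖h t‖ * (Real.sqrt (2 * Real.pi) * τ)⁻¹)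
    (fun x => (smG_integrable hτ hi x).aestronglyMeasurable) ?_ (hi.norm.mul_const _) ?_
  · intro x
    filter_upwards with t
    rw [norm_mul, Real.norm_of_nonneg (gp_pos hτ).le]
    exact mul_le_mul_of_nonneg_left (gp_le hτ) (norm_nonneg _)
  · filter_upwards with t
    exact continuous_const.mul gp_cont

/-- Measure with density `h`. -/
noncomputable def wdM (h : ℝ → ℝ) : Measure ℝ := volume.withDensity (fun t => ENNReal.ofReal (h t))

lemma wdM_fin {h : ℝ → ℝ} (hi : Integrable h) : IsFiniteMeasure (wdM h) :=
  isFiniteMeasure_withDensity_ofReal hi.2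

lemma wdM_inj {h k : ℝ → ℝ} (hc : Continuous h) (kc : Continuous k) (h0 : ∀ t, 0 ≤ h t)
    (k0 : ∀ t, 0 ≤ k t) (e : wdM h = wdM k) : h = k := by
  unfold wdM at e
  rw [withDensity_eq_iff_of_sigmaFinite (by fun_prop) (by fun_prop)] at e
  rw [← Continuous.ae_eq_iff_eq volume hc kc]
  filter_upwards [e] with t ht
  exact (ENNReal.ofReal_eq_ofReal_iff (h0 t) (k0 t)).1 ht

lemma wdM_conv {h : ℝ → ℝ} {τ : ℝ} (hτ : 0 < τ) (hc : Continuous h) (h0 : ∀ t, 0 ≤ h t)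
    (hi : Integrable h) : (wdM h).conv (gaussianReal 0 (τ ^ 2).toNNReal) = wdM (smG h τ) := by
  have hv : (τ ^ 2).toNNReal ≠ 0 := by
    rw [Ne, Real.toNNReal_eq_zero, not_le]; positivity
  rw [gaussianReal_of_var_ne_zero _ hv]
  unfold wdM
  rw [conv_withDensity_eq_lconvolution (by fun_prop) (by fun_prop)]
  congr 1
  ext x
  rw [lconvolution_def]
  unfold smG
  rw [ofReal_integral_eq_lintegral_ofReal (smG_integrable hτ hi x)
    (ae_of_all _ fun t => mul_nonneg (h0 t) (gp_pos hτ).le)]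
  congr 1
  ext t
  rw [ENNReal.ofReal_mul (h0 t), gp_shift, gp_eq hτ]
  rfl

lemma deconv {h k : ℝ → ℝ} {τ ρ : ℝ} (hτ : 0 < τ) (hρ : 0 < ρ) (hle : ρ ≤ τ)
    (hc : Continuous h) (kc : Continuous k) (h0 : ∀ t, 0 ≤ h t) (k0 : ∀ t, 0 ≤ k t)
    (hi : Integrable h) (ki : Integrable k) (e : ∀ x, smG h τ x = smG k ρ x) :
    (wdM h).conv (gaussianReal 0 (τ ^ 2 - ρ ^ 2).toNNReal) = wdM k := by
  have := wdM_fin hi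
  have := wdM_fin ki
  have e1 : (wdM h).conv (gaussianReal 0 (τ ^ 2).toNNReal)
      = (wdM k).conv (gaussianReal 0 (ρ ^ 2).toNNReal) := by
    rw [wdM_conv hτ hc h0 hi, wdM_conv hρ kc k0 ki, funext e]
  have e2 : (τ ^ 2).toNNReal = (τ ^ 2 - ρ ^ 2).toNNReal + (ρ ^ 2).toNNReal := by
    rw [← Real.toNNReal_add (by nlinarith) (by positivity)]; ring_nf
  apply Measure.ext_of_charFun
  ext a
  have e3 := congrArg (fun μ => charFun μ a) e1
  have e4 : gaussianReal 0 (τ ^ 2).toNNReal = (gaussianReal 0 (τ ^ 2 - ρ ^ 2).toNNReal).conv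
    (gaussianReal 0 (ρ ^ 2).toNNReal) := by
    rw [gaussianReal_conv_gaussianReal, e2, add_zero]
  simp only [e4, charFun_conv] at e3
  rw [← mul_assoc] at e3
  rw [charFun_conv]
  refine mul_right_cancel₀ ?_ e3
  rw [charFun_gaussianReal]
  exact Complex.exp_ne_zero _

lemma gp_tilt (t δ z : ℝ) (hδ : 0 < δ) : Real.exp (z ^ 2 / (2 * δ ^ 2)) * gaussPDF t δ z
    = (Real.sqrt (2 * Real.pi) * δ)⁻¹ * Real.exp (-t ^ 2 / (2 * δ ^ 2))
      * Real.exp (t * z / δ ^ 2) := by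
  unfold gaussPDF
  rw [mul_left_comm, mul_assoc, ← Real.exp_add, ← Real.exp_add]
  congr 2
  field_simp
  ring

lemma smG_logconvex {h : ℝ → ℝ} {δ : ℝ} (hδ : 0 < δ) (h0 : ∀ t, 0 ≤ h t)
    (hi : Integrable h) (E : ℝ → ℝ) (hE : ∀ z, E z = Real.exp (z ^ 2 / (2 * δ ^ 2)) * smG h δ z)
    (hpos : ∀ z, 0 < E z) (a b : ℝ) : E ((a + b) / 2) ^ 2 ≤ E a * E b := by
  have key : ∀ l : ℝ, 0 < l → 2 * E ((a + b) / 2) ≤ l * E a + l⁻¹ * E b := by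
    intro l hl
    simp only [hE, smG, ← integral_const_mul]
    have I : ∀ z c : ℝ, Integrable (fun t => c * (Real.exp (z ^ 2 / (2 * δ ^ 2)) *
        (h t * gaussPDF t δ z))) := fun z c =>
      ((smG_integrable hδ hi z).const_mul _).const_mul _
    rw [← integral_add (I _ _) (I _ _)]
    refine integral_mono (I _ _) ((I _ _).add (I _ _)) ?_
    intro t
    simp only
    rw [mul_left_comm (Real.exp (((a + b) / 2) ^ 2 / (2 * δ ^ 2))) (h t),
      mul_left_comm (Real.exp (a ^ 2 / (2 * δ ^ 2))) (h t),
      mul_left_comm (Real.exp (b ^ 2 / (2 * δ ^ 2))) (h t),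
      gp_tilt t _ _ hδ, gp_tilt t _ _ hδ, gp_tilt t _ _ hδ]
    have hw : 0 ≤ h t * ((Real.sqrt (2 * Real.pi) * δ)⁻¹ * Real.exp (-t ^ 2 / (2 * δ ^ 2))) :=
      mul_nonneg (h0 t) (by positivity)
    set p := Real.exp (t * a / (2 * δ ^ 2)) with hp
    set q := Real.exp (t * b / (2 * δ ^ 2)) with hq
    have ea : Real.exp (t * a / δ ^ 2) = p ^ 2 := by
      rw [hp, ← Real.exp_nat_mul]; congr 1; push_cast; field_simp
    have eb : Real.exp (t * b / δ ^ 2) = q ^ 2 := by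
      rw [hq, ← Real.exp_nat_mul]; congr 1; push_cast; field_simp
    have eab : Real.exp (t * ((a + b) / 2) / δ ^ 2) = p * q := by
      rw [hp, hq, ← Real.exp_add]; congr 1; field_simp
    rw [ea, eb, eab]
    have am : 2 * (p * q) ≤ l * p ^ 2 + l⁻¹ * q ^ 2 := by
      have : l * p ^ 2 + l⁻¹ * q ^ 2 - 2 * (p * q) = l⁻¹ * (l * p - q) ^ 2 := by
        field_simp; ring
      have : 0 ≤ l⁻¹ * (l * p - q) ^ 2 := by positivity
      linarith
    have := mul_le_mul_of_nonneg_left am hw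
    linarith
  have k := key (E ((a + b) / 2) / E a) (div_pos (hpos _) (hpos _))
  have ha := hpos a
  have hm := hpos ((a + b) / 2)
  rw [div_mul_cancel₀ _ ha.ne', inv_div] at k
  have : E ((a + b) / 2) ≤ E a / E ((a + b) / 2) * E b := by linarith
  rw [div_mul_eq_mul_div, le_div_iff₀ hm] at this
  linarith

lemma affine_of_midpoint {f : ℝ → ℝ} (hf : Continuous f)
    (h : ∀ a b, 2 * f ((a + b) / 2) = f a + f b) : ∃ a b : ℝ, ∀ x, f x = a * x + b := by
  let F : ℝ →ᵃ[ℝ] ℝ := AffineMap.ofMapMidpoint f (fun x y => by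
    rw [midpoint_eq_smul_add, midpoint_eq_smul_add]
    have := h x y
    simp only [smul_eq_mul, invOf_eq_inv]
    rw [show (2 : ℝ)⁻¹ * (x + y) = (x + y) / 2 by ring]
    linarith) hf
  refine ⟨F.linear 1, f 0, fun x => ?_⟩
  have h1 : F x = F.linear x + F 0 := by
    have := congrFun F.decomp x
    simpa using this
  have h2 : F.linear x = x * F.linear 1 := by
    have := F.linear.map_smul x 1
    simpa using this
  have h3 : ∀ u, F u = f u := fun u => rfl
  rw [← h3, ← h3, h1, h2, mul_comm]

lemma zero_of_bdd {A B : ℝ} (h : ∀ y : ℝ, y * A ≤ B) : A = 0 := by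
  by_contra hA
  have := h ((B + 1) / A)
  rw [div_mul_cancel₀ _ hA] at this
  linarith

lemma me_core
    (m m' s s' τ τ' σ σ' : ℝ) (g g' : ℝ → ℝ)
    (hs : 0 < s) (hs' : 0 < s')
    (hτ : 0 < τ) (hτ' : 0 < τ') (hσ : 0 < σ) (hσ' : 0 < σ')
    (hc : Continuous g) (hc' : Continuous g')
    (hnl' : ¬ ∃ a b : ℝ, ∀ xstar : ℝ, g' xstar = a * xstar + b)
    (hobs : ∀ x y : ℝ, covFreeDensity m s g τ σ x y = covFreeDensity m' s' g' τ' σ' x y)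
    (hle : τ' ≤ τ) :
    m = m' ∧ s = s' ∧ τ = τ' ∧ σ = σ' ∧ ∀ xstar : ℝ, g xstar = g' xstar := by
  have C : ∀ (m s σ : ℝ) (g : ℝ → ℝ) (y : ℝ), Continuous g →
      Continuous (fun t => gaussPDF m s t * gaussPDF (g t) σ y) := fun m s σ g y hg =>
    gp_cont.mul (gp_cont2.comp hg)
  have P : ∀ (m s σ : ℝ) (g : ℝ → ℝ) (y : ℝ), 0 < s → 0 < σ →
      ∀ t, 0 ≤ gaussPDF m s t * gaussPDF (g t) σ y := fun m s σ g y h1 h2 t =>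
    mul_nonneg (gp_pos h1).le (gp_pos h2).le
  have I : ∀ (m s σ : ℝ) (g : ℝ → ℝ) (y : ℝ), Continuous g → 0 < s → 0 < σ →
      Integrable (fun t => gaussPDF m s t * gaussPDF (g t) σ y) := by
    intro m s σ g y hg h1 h2
    refine (gp_int h1).mul_bdd (c := (Real.sqrt (2 * Real.pi) * σ)⁻¹)
      (gp_cont2.comp hg).aestronglyMeasurable ?_
    filter_upwards with t
    rw [Real.norm_of_nonneg (gp_pos h2).le]; exact gp_le h2
  have D : ∀ y, (wdM (fun t => gaussPDF m s t * gaussPDF (g t) σ y)).conv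
      (gaussianReal 0 (τ ^ 2 - τ' ^ 2).toNNReal)
      = wdM (fun t => gaussPDF m' s' t * gaussPDF (g' t) σ' y) := by
    intro y
    refine deconv hτ hτ' hle (C _ _ _ _ _ hc) (C _ _ _ _ _ hc') (P _ _ _ _ _ hs hσ)
      (P _ _ _ _ _ hs' hσ') (I _ _ _ _ _ hc hs hσ) (I _ _ _ _ _ hc' hs' hσ') ?_
    intro x
    have := hobs x y
    unfold covFreeDensity at this
    unfold smG
    simpa only [mul_right_comm] using this
  rcases hle.eq_or_lt with rfl | hlt
  · have E : ∀ t y, gaussPDF m s t * gaussPDF (g t) σ y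
        = gaussPDF m' s' t * gaussPDF (g' t) σ' y := by
      intro t y
      have d := D y
      have := wdM_fin (I m s σ g y hc hs hσ)
      rw [sub_self, Real.toNNReal_zero, gaussianReal_zero_var, Measure.conv_dirac_zero] at d
      exact congrFun (wdM_inj (C _ _ _ _ _ hc) (C _ _ _ _ _ hc') (P _ _ _ _ _ hs hσ)
        (P _ _ _ _ _ hs' hσ') d) t
    have F := fun t => gp_ident (gp_pos hs) (gp_pos hs') hσ hσ' (E t)
    have G := gp_ident (A := 1) (A' := 1) (a := m) (a' := m') one_pos one_pos hs hs'
      (fun t => by rw [one_mul, one_mul]; exact (F t).2.2)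
    exact ⟨G.1, G.2.1, rfl, (F 0).2.1, fun t => (F t).1⟩
  · exfalso
    apply hnl'
    apply affine_of_midpoint hc'
    have hd : 0 < τ ^ 2 - τ' ^ 2 := by nlinarith
    set δ := Real.sqrt (τ ^ 2 - τ' ^ 2) with hδd
    have hδ : 0 < δ := Real.sqrt_pos.2 hd
    have hδ2 : τ ^ 2 - τ' ^ 2 = δ ^ 2 := (Real.sq_sqrt hd.le).symm
    have E : ∀ y z, smG (fun t => gaussPDF m s t * gaussPDF (g t) σ y) δ z
        = gaussPDF m' s' z * gaussPDF (g' z) σ' y := by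
      intro y z
      have d := D y
      rw [hδ2, wdM_conv hδ (C _ _ _ _ _ hc) (P _ _ _ _ _ hs hσ) (I _ _ _ _ _ hc hs hσ)] at d
      exact congrFun (wdM_inj (smG_cont hδ (I _ _ _ _ _ hc hs hσ)) (C _ _ _ _ _ hc')
        (fun z => integral_nonneg fun t => mul_nonneg (P _ _ _ _ _ hs hσ t) (gp_pos hδ).le)
        (P _ _ _ _ _ hs' hσ') d) z
    intro a b
    have L : ∀ y, _ := fun y => smG_logconvex hδ (P m s σ g y hs hσ) (I m s σ g y hc hs hσ)
      (fun z => Real.exp (z ^ 2 / (2 * δ ^ 2)) * (gaussPDF m' s' z * gaussPDF (g' z) σ' y))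
      (fun z => by rw [E]) (fun z => mul_pos (Real.exp_pos _) (mul_pos (gp_pos hs') (gp_pos hσ')))
      a b
    -- split the log into a part free of `y` and the rest
    let W : ℝ → ℝ := fun z => Real.log (Real.exp (z ^ 2 / (2 * δ ^ 2)) * gaussPDF m' s' z)
    let K : ℝ := Real.log ((Real.sqrt (2 * Real.pi) * σ')⁻¹)
    have lg : ∀ y z, Real.log (Real.exp (z ^ 2 / (2 * δ ^ 2)) *
        (gaussPDF m' s' z * gaussPDF (g' z) σ' y))
        = W z + (K + (σ' ^ 2)⁻¹ * (-(y - g' z) ^ 2 / 2)) := by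
      intro y z
      have p1 := gp_pos (μ := m') (u := z) hs'
      have p2 := gp_pos (μ := g' z) (u := y) hσ'
      rw [← mul_assoc, Real.log_mul (by positivity) p2.ne']
      congr 1
      unfold gaussPDF
      rw [Real.log_mul (by positivity) (by positivity), Real.log_exp]
      congr 1
      rw [div_eq_mul_inv, mul_inv]; ring
    have Q : ∀ y, y * ((σ' ^ 2)⁻¹ * (2 * g' ((a + b) / 2) - (g' a + g' b)))
        ≤ W a + W b - 2 * W ((a + b) / 2) + (σ' ^ 2)⁻¹ * (g' ((a + b) / 2) ^ 2
          - g' a ^ 2 / 2 - g' b ^ 2 / 2) := by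
      intro y
      have pp : ∀ z, 0 < Real.exp (z ^ 2 / (2 * δ ^ 2)) *
        (gaussPDF m' s' z * gaussPDF (g' z) σ' y) := fun z =>
        mul_pos (Real.exp_pos _) (mul_pos (gp_pos hs') (gp_pos hσ'))
      have l := Real.log_le_log (pow_pos (pp _) 2) (L y)
      rw [Real.log_pow, Real.log_mul (pp a).ne' (pp b).ne', lg, lg, lg] at l
      push_cast at l
      linarith
    have z := zero_of_bdd Q
    have hp : 0 < (σ' ^ 2)⁻¹ := by positivity
    have := (mul_eq_zero.1 z).resolve_left hp.ne'
    linarith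

/-- Identifiability of the covariate-free Gaussian measurement error model: if two
parameterizations `(m, s, g, τ, σ)` and `(m', s', g', τ', σ')`, whose regression functions are
continuously differentiable, have finitely many critical points, and are not affine, induce the
same joint observed density of `(X, Y)`, then the parameterizations coincide. -/
theorem covariate_free_gaussian_me_identifiable
    (m m' s s' τ τ' σ σ' : ℝ) (g g' : ℝ → ℝ)
    (hs : 0 < s) (hs' : 0 < s')
    (hτ : 0 < τ) (hτ' : 0 < τ') (hσ : 0 < σ) (hσ' : 0 < σ')
    (hC1 : ContDiff ℝ 1 g) (hC1' : ContDiff ℝ 1 g')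
    (hfin : {xstar : ℝ | deriv g xstar = 0}.Finite)
    (hfin' : {xstar : ℝ | deriv g' xstar = 0}.Finite)
    (hnl : ¬ ∃ a b : ℝ, ∀ xstar : ℝ, g xstar = a * xstar + b)
    (hnl' : ¬ ∃ a b : ℝ, ∀ xstar : ℝ, g' xstar = a * xstar + b)
    (hobs : ∀ x y : ℝ, covFreeDensity m s g τ σ x y = covFreeDensity m' s' g' τ' σ' x y) :
    m = m' ∧ s = s' ∧ τ = τ' ∧ σ = σ' ∧ ∀ xstar : ℝ, g xstar = g' xstar := by
  rcases le_total τ' τ with h | h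
  · exact me_core m m' s s' τ τ' σ σ' g g' hs hs' hτ hτ' hσ hσ' hC1.continuous hC1'.continuous
      hnl' hobs h
  · obtain ⟨h1, h2, h3, h4, h5⟩ := me_core m' m s' s τ' τ σ' σ g' g hs' hs hτ' hτ hσ' hσ
      hC1'.continuous hC1.continuous hnl (fun x y => (hobs x y).symm) h
    exact ⟨h1.symm, h2.symm, h3.symm, h4.symm, fun t => (h5 t).symm⟩
end

section
/- For any real constant μ_{ΔX}, the measurement error model in which the treatment measurement noise has nonzero mean, X = X* + ΔX with ΔX ~ N(μ_{ΔX}, τ²), X* | Z = z ~ N(μ_{X*}(z), σ_{X*}(z)²), and Y = μ_Y(Z, X*) + ΔY, induces for every z exactly the same conditional distribution of the observed pair (X, Y) given Z = z as the zero-mean model with ΔX' ~ N(0, τ²), latent prior mean μ'_{X*}(z) = μ_{X*}(z) + μ_{ΔX} (same standard deviation σ_{X*}(z)), and mean function μ'_Y(z, x*) = μ_Y(z, x* − μ_{ΔX}). Consequently, the mean of the treatment measurement noise is not identifiable from the observed distribution without the zero-mean assumption. -/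
open MeasureTheory Real Set

/-- Observed conditional density `p(x, y | z)` of the CEME measurement error model whose
treatment measurement noise has (possibly nonzero) mean `μdX`:
`X* | Z = z ~ N(μX z, (σX z)²)`, `X = X* + ΔX` with `ΔX ~ N(μdX, τ²)` (so `X | X* = x*` has
density `gaussPDF (x* + μdX) τ`), and `Y = μY Z X* + ΔY` with `ΔY ~ N(0, σ²)`. -/
noncomputable def cemeDensityXMean {Z : Type*} (μX σX : Z → ℝ) (μY : Z → ℝ → ℝ)
    (τ σ μdX : ℝ) (z : Z) (x y : ℝ) : ℝ :=
  ∫ xstar : ℝ, gaussPDF (μX z) (σX z) xstar * gaussPDF (xstar + μdX) τ x *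
    gaussPDF (μY z xstar) σ y

/-- For any real constant `μdX`, the model whose treatment measurement noise
`ΔX ~ N(μdX, τ²)` has nonzero mean induces, for every `z`, exactly the same conditional
distribution of the observed pair `(X, Y)` given `Z = z` as the zero-mean model with
`ΔX' ~ N(0, τ²)`, latent prior mean `μ'_{X*}(z) = μX(z) + μdX` (same standard deviation
`σX(z)`), and mean function `μ'_Y(z, x*) = μY(z, x* − μdX)`.  Hence the mean of the treatment
measurement noise is not identifiable from the observed distribution without the zero-mean
assumption. -/
theorem treatment_noise_mean_not_identifiable {Z : Type*}
    (μX σX : Z → ℝ) (μY : Z → ℝ → ℝ) (τ σ μdX : ℝ) :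
    ∀ (z : Z) (x y : ℝ),
      cemeDensityXMean μX σX μY τ σ μdX z x y =
        cemeDensityXMean (fun z => μX z + μdX) σX
          (fun z xstar => μY z (xstar - μdX)) τ σ 0 z x y := by
  intro z x y
  unfold cemeDensityXMean
  rw [← integral_add_right_eq_self (fun xstar : ℝ => gaussPDF (μX z + μdX) (σX z) xstar *
    gaussPDF (xstar + 0) τ x * gaussPDF (μY z (xstar - μdX)) σ y) μdX]
  congr 1
  funext t
  have h : gaussPDF (μX z + μdX) (σX z) (t + μdX) = gaussPDF (μX z) (σX z) t := by
    unfold gaussPDF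
    rw [add_sub_add_right_eq_sub]
  simp only [h, add_zero, add_sub_cancel_right]
end

section
/- For every mean m ∈ ℝ and standard deviation s > 0, there do not exist constants C ∈ ℝ and A, B, D, E, F ∈ [0, ∞) such that for all x ∈ ℝ, the Gaussian density satisfies (1/(s√(2π))) · exp(−(x − m)²/(2s²)) = A · exp(−B·e^{Cx} + C·D·x) · (e^{Cx} + E)^{−F}. In other words, no Gaussian density is of the exceptional form appearing in case 2 of the Schennach–Hu identification theorem; this follows by comparing logarithms, since the log of a Gaussian density is a quadratic polynomial with nonzero quadratic term while the logarithm of the right-hand side, ln A − B·e^{Cx} + C·D·x − F·ln(e^{Cx} + E), contains no quadratic term. -/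
open Real

theorem quad_aux (a K L : ℝ) (ha : 0 < a) (h : ∀ t : ℝ, 0 ≤ t → a * t ^ 2 ≤ K + L * t) : False := by
  set t := (|K| + |L|) / a + 1 with ht
  have h0 : 0 ≤ (|K| + |L|) / a := by positivity
  have h1 : 1 ≤ t := by linarith
  have h2 : a * t = |K| + |L| + a := by rw [ht]; field_simp
  have h3 := h t (by linarith)
  have h4 : a * t ^ 2 = (|K| + |L| + a) * t := by rw [← h2]; ring
  nlinarith [le_abs_self K, le_abs_self L, abs_nonneg K, abs_nonneg L,
    mul_nonneg (abs_nonneg K) (sub_nonneg.2 h1),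
    mul_nonneg (sub_nonneg.2 (le_abs_self L)) (by linarith : (0:ℝ) ≤ t)]

/-- No Gaussian density is of the exceptional form
`f(x) = A exp(−B e^{Cx} + C D x) (e^{Cx} + E)^{−F}` with `C ∈ ℝ` and
`A, B, D, E, F ∈ [0, ∞)`, appearing in case 2 of the Schennach–Hu identification theorem:
for every mean `m ∈ ℝ` and standard deviation `s > 0` there are no such constants making the
two functions equal for all `x ∈ ℝ`. -/
theorem gaussian_density_not_exceptional (m s : ℝ) (hs : 0 < s) :
    ¬ ∃ (C A B D E F : ℝ), 0 ≤ A ∧ 0 ≤ B ∧ 0 ≤ D ∧ 0 ≤ E ∧ 0 ≤ F ∧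
      ∀ x : ℝ,
        (Real.sqrt (2 * Real.pi) * s)⁻¹ * Real.exp (-((x - m) ^ 2) / (2 * s ^ 2)) =
          A * Real.exp (-B * Real.exp (C * x) + C * D * x) *
            (Real.exp (C * x) + E) ^ (-F) := by
  rintro ⟨C, A, B, D, E, F, hA, hB, hD, hE, hF, h⟩
  have hk : 0 < (Real.sqrt (2 * Real.pi) * s)⁻¹ := by positivity
  set k := (Real.sqrt (2 * Real.pi) * s)⁻¹
  have hA' : 0 < A := by
    rcases hA.eq_or_lt with h0 | h0
    · have := h 0
      rw [← h0, zero_mul, zero_mul] at this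
      have h1 : 0 < k * Real.exp (-((0 - m) ^ 2) / (2 * s ^ 2)) := by positivity
      linarith
    · exact h0
  have key : ∀ x : ℝ, C * x ≤ 0 → (2 * s ^ 2)⁻¹ * (x - m) ^ 2 ≤
      (Real.log k - Real.log A + B + F * Real.log (1 + E)) - C * D * x := by
    intro x hx
    have hu1 : Real.exp (C * x) ≤ 1 := Real.exp_le_one_iff.2 hx
    have hu0 := Real.exp_pos (C * x)
    have hl := congrArg Real.log (h x)
    rw [Real.log_mul hk.ne' (Real.exp_pos _).ne', Real.log_exp,
      Real.log_mul (by positivity) (by positivity), Real.log_mul hA'.ne' (Real.exp_pos _).ne',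
      Real.log_exp, Real.log_rpow (by positivity)] at hl
    have h1 : Real.log (Real.exp (C * x) + E) ≤ Real.log (1 + E) :=
      Real.log_le_log (by positivity) (by linarith)
    have h2 := mul_le_mul_of_nonneg_left h1 hF
    have h3 := mul_le_mul_of_nonneg_left hu1 hB
    have h4 : -((x - m) ^ 2) / (2 * s ^ 2) = -((2 * s ^ 2)⁻¹ * (x - m) ^ 2) := by
      rw [div_eq_mul_inv]; ring
    rw [h4] at hl
    linarith
  have ha : 0 < (2 * s ^ 2)⁻¹ := by positivity
  set a := (2 * s ^ 2)⁻¹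
  set K := Real.log k - Real.log A + B + F * Real.log (1 + E)
  rcases le_total C 0 with hC | hC
  · refine quad_aux a (K - a * m ^ 2) (2 * a * m - C * D) ha fun t ht => ?_
    have := key t (mul_nonpos_of_nonpos_of_nonneg hC ht)
    linarith
  · refine quad_aux a (K - a * m ^ 2) (-(2 * a * m) + C * D) ha fun t ht => ?_
    have := key (-t) (by nlinarith)
    linarith
end

section
/- In the linear-Gaussian measurement error model with known error variances, the remaining parameters are identifiable: let X* ~ N(m, s²) with s > 0, X = X* + ΔX with ΔX ~ N(0, τ²), and Y = a + b·X* + ΔY with ΔY ~ N(0, σ²), where X*, ΔX, ΔY are mutually independent and τ ≥ 0, σ ≥ 0 are known. If two parameter tuples (a, b, m, s) and (a', b', m', s') with s, s' > 0 and the same τ and σ induce the same joint distribution of the observed pair (X, Y), then a = a', b = b', m = m', and s = s'. -/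
open MeasureTheory ProbabilityTheory

/-- Joint law of the observed pair `(X, Y)` in the linear-Gaussian measurement error model:
latent `X* ~ N(m, s²)`, observed `X = X* + ΔX` with `ΔX ~ N(0, τ²)`, and observed
`Y = a + b·X* + ΔY` with `ΔY ~ N(0, σ²)`, where `X*, ΔX, ΔY` are mutually independent. -/
noncomputable def linGaussObs (a b m s τ σ : ℝ) : Measure (ℝ × ℝ) :=
  Measure.map (fun w : ℝ × ℝ × ℝ => (w.1 + w.2.1, a + b * w.1 + w.2.2))
    ((gaussianReal m (s ^ 2).toNNReal).prod
      ((gaussianReal 0 (τ ^ 2).toNNReal).prod (gaussianReal 0 (σ ^ 2).toNNReal)))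

theorem linGaussObs_mgf (a b m s τ σ u v : ℝ) :
    ∫ p, Real.exp (u * p.1 + v * p.2) ∂(linGaussObs a b m s τ σ) =
      Real.exp (v * a + (m * (u + v * b) + s ^ 2 * (u + v * b) ^ 2 / 2)
        + (τ ^ 2 * u ^ 2 / 2 + σ ^ 2 * v ^ 2 / 2)) := by
  have key : ∀ (μ r t : ℝ), ∫ x, Real.exp (t * x) ∂(gaussianReal μ (r ^ 2).toNNReal)
      = Real.exp (μ * t + r ^ 2 * t ^ 2 / 2) := by
    intro μ r t
    have h := congrFun (mgf_id_gaussianReal (μ := μ) (v := (r ^ 2).toNNReal)) t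
    rw [Real.coe_toNNReal _ (sq_nonneg r)] at h
    simpa [mgf] using h
  unfold linGaussObs
  rw [integral_map (by fun_prop) (by fun_prop)]
  have e : ∀ w : ℝ × ℝ × ℝ,
      Real.exp (u * (w.1 + w.2.1) + v * (a + b * w.1 + w.2.2)) =
      (Real.exp (v * a) * Real.exp ((u + v * b) * w.1)) *
        (Real.exp (u * w.2.1) * Real.exp (v * w.2.2)) := by
    intro w
    simp only [← Real.exp_add]
    congr 1
    ring
  simp only [e]
  rw [integral_prod_mul (fun x : ℝ => Real.exp (v * a) * Real.exp ((u + v * b) * x))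
    (fun y : ℝ × ℝ => Real.exp (u * y.1) * Real.exp (v * y.2)),
    integral_prod_mul (fun x : ℝ => Real.exp (u * x)) (fun x : ℝ => Real.exp (v * x)),
    integral_const_mul, key, key, key]
  simp only [← Real.exp_add]
  congr 1
  ring

/-- Identifiability of the linear-Gaussian measurement error model with known error variances:
if two parameter tuples `(a, b, m, s)` and `(a', b', m', s')` with `s, s' > 0` and the same
known `τ ≥ 0` and `σ ≥ 0` induce the same joint distribution of the observed pair `(X, Y)`,
then `a = a'`, `b = b'`, `m = m'`, and `s = s'`. -/
theorem linear_gaussian_known_error_variances_identifiable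
    (a a' b b' m m' s s' τ σ : ℝ) (hs : 0 < s) (hs' : 0 < s')
    (hτ : 0 ≤ τ) (hσ : 0 ≤ σ)
    (hobs : linGaussObs a b m s τ σ = linGaussObs a' b' m' s' τ σ) :
    a = a' ∧ b = b' ∧ m = m' ∧ s = s' := by
  have h : ∀ u v : ℝ, v * a + (m * (u + v * b) + s ^ 2 * (u + v * b) ^ 2 / 2)
      = v * a' + (m' * (u + v * b') + s' ^ 2 * (u + v * b') ^ 2 / 2) := by
    intro u v
    have h1 := linGaussObs_mgf a b m s τ σ u v
    rw [hobs, linGaussObs_mgf] at h1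
    have h2 := Real.exp_injective h1
    linarith
  have h1 := h 1 0
  have h2 := h (-1) 0
  have hm : m = m' := by linarith
  have hs2 : s ^ 2 = s' ^ 2 := by linarith
  have hss : s = s' := by
    rwa [sq_eq_sq₀ hs.le hs'.le] at hs2
  subst hm
  subst hss
  have h3 := h 1 1
  have h4 := h (-1) 1
  have hb : b = b' := by
    have : s ^ 2 * b = s ^ 2 * b' := by linarith
    exact mul_left_cancel₀ (by positivity) this
  subst hb
  exact ⟨by linarith, rfl, rfl, rfl⟩
end
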